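/- Let 𝕏 = {p_1,…,p_s} ⊆ ℙ^n_K be a (2, r_𝕏 − 1)-uniform set of s distinct K-rational points, none lying on Z(X_0). If 𝕏 is an almost Gorenstein scheme and r_𝕏 ≥ 2, then Δ_𝕏 = 1. -/

import Mathlib

noncomputable section

/-! An algebraic model for a 0-dimensional subscheme `𝕏 ⊆ ℙⁿ_K` whose support avoids
the hyperplane `Z(X₀)`.  The scheme is recorded through the local rings
`𝒪_{𝕏,p_j}` at the points `p_1, …, p_s` of its support, together with the germ map
sending a homogeneous polynomial `F` of degree `i` to the tuple of germs
`(F_{p_1}, …, F_{p_s})`; this is the degree-`i` component of the injection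
`ĩ : R → Q^h(R) ≅ ∏_j 𝒪_{𝕏,p_j}[T_j, T_j⁻¹]`, where every graded component of
`Q^h(R)` is identified with `Γ = ∏_j 𝒪_{𝕏,p_j}` by dropping the powers of the `T_j`.
Since `x₀` has germ `1` at every point, the homogeneous coordinate ring
`R = P/I_𝕏` is faithfully encoded by the chain of subspaces
`R_i ≅ V_i = germ(P_i) ⊆ Γ` (with `V_i ⊆ V_{i+1}`, and `V_i = Γ` for `i ≫ 0`). -/

/-- The data of one (fat) point of a 0-dimensional scheme: a finite local `K`-algebra. -/
structure PointData (K : Type) [Field K] : Type 1 where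
  carrier : Type
  [ring : CommRing carrier]
  [alg : Algebra K carrier]
  [loc : IsLocalRing carrier]
  [findim : FiniteDimensional K carrier]

attribute [instance] PointData.ring PointData.alg PointData.loc PointData.findim

/-- A model of a 0-dimensional subscheme of `ℙⁿ_K`, no point of whose support lies
on `Z(X₀)` (coordinates being chosen so that each point has `X₀`-coordinate 1, the
germ of `x₀` at every point is `1`). -/
structure ZeroDimScheme (K : Type) [Field K] (n : ℕ) : Type 1 where
  /-- the number of points in the support -/
  s : ℕ
  spos : 0 < s
  /-- the local rings `𝒪_{𝕏,p_j}` -/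
  pt : Fin s → PointData K
  /-- the germ map: for `F` homogeneous of degree `i` this is the degree-`i`
  component of `ĩ : R → Q^h(R)`, i.e. `F ↦ (F_{p_1}, …, F_{p_s})` -/
  germ : MvPolynomial (Fin (n + 1)) K →ₐ[K] ∀ j, (pt j).carrier
  /-- the germ of `X₀` at each point is `1` -/
  germ_X0 : germ (MvPolynomial.X 0) = 1
  /-- in all large degrees, the germ map is surjective onto `∏_j 𝒪_{𝕏,p_j}`
  (this characterizes `I_𝕏` as the full homogeneous vanishing ideal of the scheme) -/
  eventually_surj : ∃ N : ℕ, ∀ i, N ≤ i →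
    Submodule.map germ.toLinearMap
      (MvPolynomial.homogeneousSubmodule (Fin (n + 1)) K i) = ⊤

namespace ZeroDimScheme

variable {K : Type} [Field K] {n : ℕ}

/-- `Γ = ∏_j 𝒪_{𝕏,p_j}`, the common model for every graded component of `Q^h(R)`. -/
abbrev Gamma (S : ZeroDimScheme K n) : Type := ∀ j, (S.pt j).carrier

variable (S : ZeroDimScheme K n)

/-- `V i ⊆ Γ` is the image of the degree-`i` component `R_i` of the homogeneous
coordinate ring `R` under (the degree-`i` component of) `ĩ`; we identify `R_i ≅ V i`. -/
def V (i : ℕ) : Submodule K S.Gamma :=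
  Submodule.map S.germ.toLinearMap
    (MvPolynomial.homogeneousSubmodule (Fin (n + 1)) K i)

/-- `R_i` for `i : ℤ` (zero in negative degrees). -/
def Vz (i : ℤ) : Submodule K S.Gamma := if 0 ≤ i then S.V i.toNat else ⊥

/-- `deg 𝕏 = Σ_j dim_K 𝒪_{𝕏,p_j}`. -/
def degX : ℕ := Module.finrank K S.Gamma

/-- The Hilbert function `HF_𝕏(i) = dim_K R_i`. -/
def HF (i : ℕ) : ℕ := Module.finrank K (S.V i)

/-- The Hilbert function on `ℤ`. -/
def HFz (i : ℤ) : ℕ := Module.finrank K (S.Vz i)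

/-- The regularity index `r_𝕏`: the least `r` with `HF_𝕏(i) = deg 𝕏` for all `i ≥ r`. -/
def rX : ℕ := sInf {r : ℕ | ∀ i, r ≤ i → S.HF i = S.degX}

/-- `κ_j = dim_K κ(p_j)`, the residue field of `𝕏` at `p_j`. -/
def kappa (j : Fin S.s) : ℕ :=
  Module.finrank K
    ((S.pt j).carrier ⧸
      Submodule.restrictScalars K (IsLocalRing.maximalIdeal (S.pt j).carrier))

/-- `sj` is a socle element of `𝒪_{𝕏,p_j}`, i.e. `sj ∈ Ann(𝔪_{𝕏,p_j})`.  By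
Proposition 1.2, the maximal `p_j`-subschemes `𝕐 ⊆ 𝕏` correspond 1-1 to the ideals
of `Γ` generated by `(0,…,0,sj,0,…,0)` with `sj` a *nonzero* socle element. -/
def IsSocle (j : Fin S.s) (sj : (S.pt j).carrier) : Prop :=
  ∀ b ∈ IsLocalRing.maximalIdeal (S.pt j).carrier, sj * b = 0

/-- The ideal `U = ⟨(0,…,0,sj,0,…,0)⟩` of `Γ` corresponding to the maximal
`p_j`-subscheme `𝕐` determined by the socle element `sj`; one has `I_{𝕐/𝕏} = ĩ⁻¹(U)`. -/
def sepIdeal (j : Fin S.s) (sj : (S.pt j).carrier) : Submodule K S.Gamma :=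
  Submodule.restrictScalars K (Ideal.span {(Pi.single j sj : S.Gamma)})

/-- The degree-`i` component `(I_{𝕐/𝕏})_i = R_i ∩ ĩ⁻¹(U)` of the ideal of the maximal
`p_j`-subscheme `𝕐` (given by the socle element `sj`) in `R`. -/
def IY (j : Fin S.s) (sj : (S.pt j).carrier) (i : ℕ) : Submodule K S.Gamma :=
  S.V i ⊓ S.sepIdeal j sj

/-- `(I_{𝕐/𝕏})_i` for `i : ℤ`. -/
def IYz (j : Fin S.s) (sj : (S.pt j).carrier) (i : ℤ) : Submodule K S.Gamma :=
  S.Vz i ⊓ S.sepIdeal j sj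

/-- The Hilbert function `HF_𝕐(i) = HF_𝕏(i) - dim_K (I_{𝕐/𝕏})_i` of the maximal
`p_j`-subscheme `𝕐` given by the socle element `sj`. -/
def HFY (j : Fin S.s) (sj : (S.pt j).carrier) (i : ℕ) : ℕ :=
  S.HF i - Module.finrank K (S.IY j sj i)

/-- `HF_𝕐` on `ℤ`. -/
def HFYz (j : Fin S.s) (sj : (S.pt j).carrier) (i : ℤ) : ℕ :=
  S.HFz i - Module.finrank K (S.IYz j sj i)

/-- `α_{𝕐/𝕏} = min {i | (I_{𝕐/𝕏})_i ≠ 0}`. -/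
def alphaY (j : Fin S.s) (sj : (S.pt j).carrier) : ℕ :=
  sInf {i : ℕ | S.IY j sj i ≠ ⊥}

/-- `μ(a) = min {i | (0,…,0,a T_j^i,0,…,0) ∈ ĩ(R)}` for `a ∈ 𝒪_{𝕏,p_j}`. -/
def mu (j : Fin S.s) (a : (S.pt j).carrier) : ℕ :=
  sInf {i : ℕ | (Pi.single j a : S.Gamma) ∈ S.V i}

/-- `μ_{𝕐/𝕏}`, the maximal degree of a minimal separator of the maximal
`p_j`-subscheme `𝕐` given by the socle element `sj`; independently of all choices it
equals `max {μ(a·sj) | a ∈ 𝒪_{𝕏,p_j}, a·sj ≠ 0}`. -/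
def muY (j : Fin S.s) (sj : (S.pt j).carrier) : ℕ :=
  sSup {m : ℕ | ∃ a : (S.pt j).carrier, a * sj ≠ 0 ∧ m = S.mu j (a * sj)}

/-- `deg_𝕏(p_j) = min {μ_{𝕐/𝕏} | 𝕐 a maximal p_j-subscheme of 𝕏}`. -/
def degP (j : Fin S.s) : ℕ :=
  sInf {m : ℕ | ∃ sj : (S.pt j).carrier, S.IsSocle j sj ∧ sj ≠ 0 ∧ m = S.muY j sj}

/-- `𝕏` has the Cayley–Bacharach property of degree `d`: `deg_𝕏(p_j) ≥ d + 1` for all `j`. -/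
def CBP (d : ℕ) : Prop := ∀ j : Fin S.s, d + 1 ≤ S.degP j

/-- `𝕏` is a Cayley–Bacharach scheme: it has `CBP(r_𝕏 - 1)`. -/
def CayleyBacharach : Prop := S.CBP (S.rX - 1)

/-- The residue class map `𝒪_{𝕏,p_j} → κ(p_j)` as a `K`-linear map. -/
def resQ (j : Fin S.s) :
    (S.pt j).carrier →ₗ[K]
      ((S.pt j).carrier ⧸
        Submodule.restrictScalars K (IsLocalRing.maximalIdeal (S.pt j).carrier)) :=
  (Submodule.restrictScalars K (IsLocalRing.maximalIdeal (S.pt j).carrier)).mkQ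

/-- The residue classes of `e 0, …, e (κ_j - 1)` form a `K`-basis of `κ(p_j)`. -/
def IsResidueBasis (j : Fin S.s) {m : ℕ} (e : Fin m → (S.pt j).carrier) : Prop :=
  LinearIndependent K (fun k => S.resQ j (e k)) ∧
    Submodule.span K (Set.range fun k => S.resQ j (e k)) = ⊤

/-- A family `τ_j : 𝒪_{𝕏,p_j} → K` of trace maps: each `τ_j` is a generator of
`Hom_K(𝒪_{𝕏,p_j}, K)` as an `𝒪_{𝕏,p_j}`-module.  Such a family exists iff `𝕏` is
locally Gorenstein, and it induces a homogeneous trace map `σ` of degree zero of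
`Q^h(R)/L₀` (componentwise). -/
def IsTraceFamily (τ : ∀ j, (S.pt j).carrier →ₗ[K] K) : Prop :=
  ∀ j, Function.Bijective
    (fun a : (S.pt j).carrier => (τ j).comp (LinearMap.mulRight K a))

/-- The total trace `Γ → K`, `y ↦ Σ_j τ_j (y_j)`; on the degree-`i` component of
`Q^h(R)` the trace map `σ` is `q ↦ (Ttot τ q)·x₀^i`. -/
def Ttot (τ : ∀ j, (S.pt j).carrier →ₗ[K] K) : S.Gamma →ₗ[K] K :=
  ∑ j : Fin S.s, (τ j).comp (LinearMap.proj j)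

/-- The degree-`k` component `(𝔠^σ_𝕏)_k ⊆ Q^h(R)_k ≅ Γ` of the Dedekind complementary
module: `g ∈ (𝔠^σ_𝕏)_k` iff `σ(g · R) ⊆ K[x₀]`, i.e. `Ttot τ (g·x) = 0` whenever
`x ∈ R_i` with `k + i < 0`. -/
def Cmod (τ : ∀ j, (S.pt j).carrier →ₗ[K] K) (k : ℤ) : Submodule K S.Gamma :=
  ⨅ (i : ℕ) (_ : k + (i : ℤ) < 0) (x : S.Gamma) (_ : x ∈ S.V i),
    LinearMap.ker ((S.Ttot τ).comp (LinearMap.mulRight K x))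

/-- The degree-`i` component `(δ^σ_𝕏)_i ⊆ Q^h(R)_i ≅ Γ` of the Dedekind different
`δ^σ_𝕏 = {f ∈ Q^h(R) | f · 𝔠^σ_𝕏 ⊆ R}`. -/
def delta (τ : ∀ j, (S.pt j).carrier →ₗ[K] K) (i : ℤ) : Submodule K S.Gamma :=
  ⨅ (k : ℤ) (g : S.Gamma) (_ : g ∈ S.Cmod τ k),
    Submodule.comap (LinearMap.mulRight K g) (S.Vz (i + k))

/-- The Hilbert function of the Dedekind different. -/
def HFdelta (τ : ∀ j, (S.pt j).carrier →ₗ[K] K) (i : ℤ) : ℕ :=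
  Module.finrank K (S.delta τ i)

/-- `𝕏` has minimal Dedekind different: `δ^σ_𝕏 = ⊕_{i ≥ 2 r_𝕏} R_i`
(recall `R_i ≅ Γ` for `i ≥ r_𝕏`). -/
def MinimalDedekind (τ : ∀ j, (S.pt j).carrier →ₗ[K] K) : Prop :=
  ∀ i : ℤ, S.delta τ i = if 2 * (S.rX : ℤ) ≤ i then ⊤ else ⊥

/-- The degree-`i` component (`i ≥ 0`) of the conductor
`𝔉_{R̃/R} = {f ∈ R̃ | f·R̃ ⊆ R}` of `R` in `R̃ = ∏_j 𝒪_{𝕏,p_j}[T_j]`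
(whose degree-`i` component is all of `Γ` for every `i ≥ 0`). -/
def cond (i : ℕ) : Submodule K S.Gamma :=
  ⨅ y : S.Gamma, Submodule.comap (LinearMap.mulRight K y) (S.V i)

/-- The conductor on `ℤ` (zero in negative degrees, where `R̃` vanishes). -/
def condZ (i : ℤ) : Submodule K S.Gamma := if 0 ≤ i then S.cond i.toNat else ⊥

/-- The degree-`i` component of the trace `tr(𝔠^σ_𝕏) = δ^σ_𝕏 · 𝔠^σ_𝕏` of the
Dedekind complementary module. -/
def trC (τ : ∀ j, (S.pt j).carrier →ₗ[K] K) (i : ℤ) : Submodule K S.Gamma :=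
  ⨆ (a : ℤ) (b : ℤ) (_ : a + b = i), S.delta τ a * S.Cmod τ b

/-- `𝕏` is nearly Gorenstein: `𝔪 ⊆ tr(𝔠^σ_𝕏)`. -/
def NearlyGorenstein (τ : ∀ j, (S.pt j).carrier →ₗ[K] K) : Prop :=
  ∀ i : ℤ, 1 ≤ i → S.Vz i ≤ S.trC τ i

/-- `𝕏` is almost Gorenstein: there is an exact sequence of graded `R`-modules
`0 → R → 𝔠^σ_𝕏(-r_𝕏) → C → 0` with `𝔪·C = 0`.  A degree-zero graded injection
`R → 𝔠^σ_𝕏(-r_𝕏)` is multiplication by an element `g ∈ (𝔠^σ_𝕏)_{-r_𝕏}` with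
`Ann_R(g) = 0`, and `𝔪·C = 0` means `𝔪 · 𝔠^σ_𝕏(-r_𝕏) ⊆ g·R`. -/
def AlmostGorenstein (τ : ∀ j, (S.pt j).carrier →ₗ[K] K) : Prop :=
  ∃ g ∈ S.Cmod τ (-(S.rX : ℤ)),
    (∀ i : ℕ, ∀ x ∈ S.V i, x * g = 0 → x = 0) ∧
    (∀ a : ℕ, 1 ≤ a → ∀ x ∈ S.V a, ∀ k : ℤ, ∀ h ∈ S.Cmod τ k,
      x * h ∈ Submodule.map (LinearMap.mulRight K g) (S.Vz ((a : ℤ) + k + (S.rX : ℤ))))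

/-- `𝕏` is arithmetically Gorenstein, i.e. `R` is a Gorenstein ring; equivalently the
canonical module is free of rank one: `𝔠^σ_𝕏 = g·R` for some `g ∈ (𝔠^σ_𝕏)_{-r_𝕏}`. -/
def ArithGorenstein (τ : ∀ j, (S.pt j).carrier →ₗ[K] K) : Prop :=
  ∃ g ∈ S.Cmod τ (-(S.rX : ℤ)),
    ∀ k : ℤ, S.Cmod τ k = Submodule.map (LinearMap.mulRight K g) (S.Vz (k + (S.rX : ℤ)))

/-- `𝕏` is level: the socle of `R̄ = R/⟨x₀⟩` equals `R̄_{r_𝕏}`, i.e. no nonzero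
homogeneous element of `R̄` of degree `< r_𝕏` is annihilated by `𝔪̄` (recall
`R̄_i ≅ V i / V (i-1)` and `x₀`-multiplication preserves germs). -/
def Level : Prop :=
  ∀ i : ℕ, i < S.rX → ∀ x ∈ S.V i,
    (∀ a : ℕ, 1 ≤ a → ∀ y ∈ S.V a, x * y ∈ S.Vz ((i : ℤ) + (a : ℤ) - 1)) →
      x ∈ S.Vz ((i : ℤ) - 1)

/-- The subspace `{x ∈ Γ | x_k = 0 for k ≠ j}` of `Γ`: the degreewise model for the
ideal of the subscheme `𝕐_j ⊆ 𝕏` with `I_{𝕐_j} = ∩_{k ≠ j} I_k`. -/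
def Wj (j : Fin S.s) : Submodule K S.Gamma :=
  ⨅ (k : Fin S.s) (_ : k ≠ j),
    LinearMap.ker (LinearMap.proj k : S.Gamma →ₗ[K] (S.pt k).carrier)

/-- `(I_{𝕐_j/𝕏})_i` for the subscheme `𝕐_j` complementary to `p_j`. -/
def IW (j : Fin S.s) (i : ℕ) : Submodule K S.Gamma := S.V i ⊓ S.Wj j

/-- The Hilbert function of the subscheme `𝕐_j` complementary to `p_j`. -/
def HFW (j : Fin S.s) (i : ℕ) : ℕ := S.HF i - Module.finrank K (S.IW j i)

/-- `α_{𝕐_j/𝕏}` for the subscheme `𝕐_j` complementary to `p_j`. -/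
def alphaW (j : Fin S.s) : ℕ := sInf {i : ℕ | S.IW j i ≠ ⊥}

/-- The subspace `{x ∈ Γ | x_k = 0 for k ∉ {j₁, j₂}}` of `Γ`: the degreewise model for
the ideal in `R` of the subscheme of the reduced scheme `𝕏` complementary to `{p_{j₁}, p_{j₂}}`. -/
def Wpair (j1 j2 : Fin S.s) : Submodule K S.Gamma :=
  ⨅ (k : Fin S.s) (_ : k ≠ j1) (_ : k ≠ j2),
    LinearMap.ker (LinearMap.proj k : S.Gamma →ₗ[K] (S.pt k).carrier)

/-- The homogeneous vanishing ideal `I_𝕏 ⊆ P`. -/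
def IX : Ideal (MvPolynomial (Fin (n + 1)) K) :=
  Ideal.span {F | (∃ i : ℕ, F ∈ MvPolynomial.homogeneousSubmodule (Fin (n + 1)) K i) ∧
    S.germ F = 0}

/-- The `n×n`-minor (Jacobian determinant with respect to `X_1, …, X_n`) of an
`n`-tuple of polynomials. -/
def jacMinor (Fs : Fin n → MvPolynomial (Fin (n + 1)) K) : MvPolynomial (Fin (n + 1)) K :=
  Matrix.det (Matrix.of fun a b : Fin n => MvPolynomial.pderiv (Fin.succ b) (Fs a))

/-- The preimage in `P` of the Kähler different `ϑ_𝕏 ⊆ R`: the ideal generated by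
`I_𝕏` together with all `n×n` minors of the Jacobian matrix of elements of `I_𝕏`. -/
def KaehlerIdeal : Ideal (MvPolynomial (Fin (n + 1)) K) :=
  S.IX ⊔ Ideal.span {m | ∃ Fs : Fin n → MvPolynomial (Fin (n + 1)) K,
    (∀ a, Fs a ∈ S.IX) ∧ m = jacMinor Fs}

/-- The degree-`i` component of the Kähler different `ϑ_𝕏 ⊆ R`, viewed inside `Γ`. -/
def thetaPiece (i : ℕ) : Submodule K S.Gamma :=
  Submodule.map S.germ.toLinearMap
    (Submodule.restrictScalars K S.KaehlerIdeal ⊓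
      MvPolynomial.homogeneousSubmodule (Fin (n + 1)) K i)

end ZeroDimScheme

end
namespace ZeroDimScheme

theorem aux_one_mem {K : Type} [Field K] {n : ℕ} (S : ZeroDimScheme K n) (i : ℕ) :
    (1 : S.Gamma) ∈ S.V i := by
  refine ⟨MvPolynomial.X 0 ^ i, ?_, ?_⟩
  · have := (MvPolynomial.isHomogeneous_X K (0 : Fin (n+1))).pow i
    simpa using this
  · simp [S.germ_X0]

theorem aux_mono {K : Type} [Field K] {n : ℕ} (S : ZeroDimScheme K n) {i j : ℕ} (h : i ≤ j) :
    S.V i ≤ S.V j := by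
  rintro _ ⟨F, hF, rfl⟩
  obtain ⟨d, rfl⟩ := Nat.exists_eq_add_of_le h
  refine ⟨F * MvPolynomial.X 0 ^ d, ?_, ?_⟩
  · have h1 := (MvPolynomial.isHomogeneous_X K (0 : Fin (n+1))).pow d
    have h2 : F.IsHomogeneous i := hF
    have := h2.mul h1
    simpa using this
  · simp [S.germ_X0]

theorem aux_alg {K : Type} [Field K] {n : ℕ} (S : ZeroDimScheme K n)
    (hrat : ∀ j, Module.finrank K (S.pt j).carrier = 1) (j : Fin S.s) (a : (S.pt j).carrier) :
    ∃ c : K, a = algebraMap K _ c := by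
  obtain ⟨c, hc⟩ := (finrank_eq_one_iff_of_nonzero' (1 : (S.pt j).carrier) one_ne_zero).1 (hrat j) a
  exact ⟨c, by rw [Algebra.algebraMap_eq_smul_one, hc]⟩

theorem aux_nzd {K : Type} [Field K] {n : ℕ} (S : ZeroDimScheme K n)
    (hrat : ∀ j, Module.finrank K (S.pt j).carrier = 1) (j : Fin S.s) (a b : (S.pt j).carrier)
    (h : a * b = 0) : a = 0 ∨ b = 0 := by
  obtain ⟨c, rfl⟩ := S.aux_alg hrat j a
  obtain ⟨d, rfl⟩ := S.aux_alg hrat j b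
  rw [← map_mul, map_eq_zero_iff _ (algebraMap K _).injective, mul_eq_zero] at h
  rcases h with h | h <;> simp [h]

theorem aux_rep {K : Type} [Field K] {n : ℕ} (S : ZeroDimScheme K n)
    (hrat : ∀ j, Module.finrank K (S.pt j).carrier = 1)
    (τ : ∀ j, (S.pt j).carrier →ₗ[K] K) (hτ1 : ∀ j, τ j 1 = 1) (φ : S.Gamma →ₗ[K] K)
    (x : S.Gamma) :
    S.Ttot τ ((fun j => algebraMap K _ (φ (Pi.single j 1)) : S.Gamma) * x) = φ x := by
  choose c hc using fun j => S.aux_alg hrat j (x j)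
  have hx : x = ∑ j, c j • (Pi.single j 1 : S.Gamma) := by
    conv_lhs => rw [← Finset.univ_sum_single x]
    refine Finset.sum_congr rfl fun j _ => ?_
    rw [hc j, Algebra.algebraMap_eq_smul_one, Pi.single_smul]
  have hR : φ x = ∑ j, c j * φ (Pi.single j 1) := by
    conv_lhs => rw [hx]
    simp
  rw [hR]
  simp only [Ttot, LinearMap.sum_apply, LinearMap.comp_apply, LinearMap.proj_apply, Pi.mul_apply]
  refine Finset.sum_congr rfl fun j _ => ?_
  rw [hc j, ← map_mul, Algebra.algebraMap_eq_smul_one, map_smul, hτ1, smul_eq_mul, mul_one,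
    mul_comm]

theorem aux_exists {K : Type} [Field K] {n : ℕ} (S : ZeroDimScheme K n)
    (hrat : ∀ j, Module.finrank K (S.pt j).carrier = 1)
    (τ : ∀ j, (S.pt j).carrier →ₗ[K] K)
    (hτ1 : ∀ j, τ j 1 = 1)
    (hunif : ∀ j1 j2 : Fin S.s, j1 ≠ j2 →
      S.V (S.rX - 1) ⊓ S.Wpair j1 j2 = ⊥) (j k : Fin S.s) (hjk : j ≠ k) :
    ∃ h ∈ S.Cmod τ (-(S.rX : ℤ)), h j ≠ 0 ∧ h k = 0 := by
  have hnot : (Pi.single j 1 : S.Gamma) ∉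
      S.V (S.rX - 1) ⊔ Submodule.span K {(Pi.single k 1 : S.Gamma)} := by
    intro hm
    obtain ⟨v, hv, u, hu, huv⟩ := Submodule.mem_sup.1 hm
    obtain ⟨c, rfl⟩ := Submodule.mem_span_singleton.1 hu
    have hv' : v ∈ S.V (S.rX - 1) ⊓ S.Wpair j k := by
      refine ⟨hv, ?_⟩
      simp only [Wpair, SetLike.mem_coe, Submodule.mem_iInf, LinearMap.mem_ker,
        LinearMap.proj_apply]
      intro l h1 h2
      have := congrFun huv l
      simpa [Pi.single_eq_of_ne h1, Pi.single_eq_of_ne h2] using this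
    rw [hunif j k hjk, Submodule.mem_bot] at hv'
    have := congrFun huv j
    simp [hv', Pi.single_eq_of_ne hjk] at this
  obtain ⟨φ, h1, h2⟩ := Submodule.exists_le_ker_of_notMem hnot
  refine ⟨fun l => algebraMap K _ (φ (Pi.single l 1)), ?_, ?_, ?_⟩
  · simp only [Cmod, Submodule.mem_iInf, LinearMap.mem_ker]
    intro i hi x hx
    have := S.aux_rep hrat τ hτ1 φ x
    refine Eq.trans this ?_
    exact h2 (Submodule.mem_sup_left (S.aux_mono (by omega) hx))
  · simpa using h1
  · have : φ (Pi.single k 1) = 0 :=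
      h2 (Submodule.mem_sup_right (Submodule.mem_span_singleton_self _))
    simp [this]

theorem aux_two {K : Type} [Field K] {n : ℕ} (S : ZeroDimScheme K n)
    (hrat : ∀ j, Module.finrank K (S.pt j).carrier = 1) (hr : 2 ≤ S.rX) : 2 ≤ S.s := by
  by_contra hs
  have hs1 : S.s = 1 := by have := S.spos; omega
  have hd : S.degX = 1 := by
    unfold degX
    rw [Module.finrank_pi_fintype]
    simp [hrat, hs1]
  have : S.rX ≤ 0 := by
    apply Nat.sInf_le
    intro i _
    have h1 : S.HF i ≤ S.degX := Submodule.finrank_le _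
    have h2 : 0 < S.HF i := by
      unfold HF
      haveI : Nontrivial (S.V i) := by
        refine ⟨⟨⟨1, S.aux_one_mem i⟩, 0, ?_⟩⟩
        intro h
        have := congrFun (congrArg Subtype.val h) ⟨0, S.spos⟩
        exact one_ne_zero this
      exact Module.finrank_pos
    omega
  omega

end ZeroDimScheme

/-- Proposition 6.13.  Let `𝕏 = {p_1, …, p_s} ⊆ ℙⁿ_K` be a
`(2, r_𝕏 - 1)`-uniform set of distinct `K`-rational points, none on `Z(X₀)` (with
the canonical trace family): every subscheme `𝕐 ⊆ 𝕏` of degree `s - 2` — i.e. the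
complement of two distinct points `p_{j₁}, p_{j₂}` — satisfies
`HF_𝕐(r_𝕏 - 1) = HF_𝕏(r_𝕏 - 1)`, which says degreewise that
`V (r_𝕏 - 1) ⊓ Wpair j₁ j₂ = ⊥`.  If `𝕏` is an almost Gorenstein scheme and
`r_𝕏 ≥ 2`, then `Δ_𝕏 = deg 𝕏 - HF_𝕏(r_𝕏 - 1) = 1`. -/
theorem dedekind_CB_stmt19 (K : Type) [Field K] (n : ℕ) (S : ZeroDimScheme K n)
    (hrat : ∀ j, Module.finrank K (S.pt j).carrier = 1)
    (τ : ∀ j, (S.pt j).carrier →ₗ[K] K) (hτ : S.IsTraceFamily τ)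
    (hτ1 : ∀ j, τ j 1 = 1)
    (hunif : ∀ j1 j2 : Fin S.s, j1 ≠ j2 →
      S.V (S.rX - 1) ⊓ S.Wpair j1 j2 = ⊥)
    (hAG : S.AlmostGorenstein τ) (hr : 2 ≤ S.rX) :
    S.degX - S.HF (S.rX - 1) = 1 := by
  exfalso
  obtain ⟨g, hg, hinj, hmul⟩ := hAG
  have hs := S.aux_two hrat hr
  have hg0 : ∀ j, g j ≠ 0 := by
    intro j hj
    obtain ⟨N, hN⟩ := S.eventually_surj
    have hm : (Pi.single j 1 : S.Gamma) ∈ S.V N := by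
      unfold ZeroDimScheme.V
      rw [hN N le_rfl]; trivial
    have h0 := hinj N _ hm (by
      ext l
      by_cases h : l = j
      · subst h; simp [hj]
      · simp [Pi.single_eq_of_ne h])
    have := congrFun h0 j
    simp at this
  let j : Fin S.s := ⟨0, by omega⟩
  let k : Fin S.s := ⟨1, by omega⟩
  have hjk : j ≠ k := by simp [j, k]
  have key : ∀ T : Finset (Fin S.s), j ∉ T →
      ∃ y ∈ S.V (S.rX - 1), y j ≠ 0 ∧ ∀ l ∈ T, y l = 0 := by
    intro T
    induction T using Finset.induction_on with
    | empty => exact fun _ => ⟨1, S.aux_one_mem _, by simp, by simp⟩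
    | insert a T ha ih =>
      intro hj
      rw [Finset.mem_insert, not_or] at hj
      obtain ⟨x, hx, hxj, hxT⟩ := ih hj.2
      obtain ⟨h, hh, hhj, hha⟩ := S.aux_exists hrat τ hτ1 hunif j a hj.1
      obtain ⟨y, hy, hyx⟩ := hmul (S.rX - 1) (by omega) x hx _ h hh
      have e : ((S.rX - 1 : ℕ) : ℤ) + -(S.rX : ℤ) + (S.rX : ℤ) = ((S.rX - 1 : ℕ) : ℤ) := by ring
      rw [e] at hy
      have hyx' : ∀ l, y l * g l = x l * h l := fun l => congrFun hyx l
      refine ⟨y, by simpa [ZeroDimScheme.Vz] using hy, ?_, ?_⟩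
      · intro h0
        have := hyx' j
        rw [h0, zero_mul] at this
        rcases S.aux_nzd hrat j _ _ this.symm with h | h
        · exact hxj h
        · exact hhj h
      · intro l hl
        have h0 : y l * g l = 0 := by
          rw [hyx' l]
          rcases Finset.mem_insert.1 hl with rfl | hl
          · rw [hha, mul_zero]
          · rw [hxT l hl, zero_mul]
        exact (S.aux_nzd hrat l _ _ h0).resolve_right (hg0 l)
  obtain ⟨y, hy, hyj, hy0⟩ := key (Finset.univ.erase j) (by simp)
  have hmem : y ∈ S.V (S.rX - 1) ⊓ S.Wpair j k := by
    refine ⟨hy, ?_⟩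
    simp only [ZeroDimScheme.Wpair, SetLike.mem_coe, Submodule.mem_iInf, LinearMap.mem_ker,
      LinearMap.proj_apply]
    intro l h1 _
    exact hy0 l (by simp [h1])
  rw [hunif j k hjk, Submodule.mem_bot] at hmem
  exact hyj (by rw [hmem]; rfl)
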